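/- Fix 0 ≤ l ≤ n and let J_l ∈ Sp(n,ℝ) be the block matrix with block rows ((I,0,0,0),(0,0,0,−I),(0,0,I,0),(0,I,0,0)), where the diagonal square blocks have sizes l, n−l, l, n−l. For a Schwartz function f on ℝⁿ, define (R_{J_l} f)(x) = ∫_{ℝ^{n−l}} f(x⁽¹⁾, u) · e(−x⁽²⁾ uᵀ) du, where x = (x⁽¹⁾, x⁽²⁾) ∈ ℝˡ × ℝ^{n−l} (the partial Fourier transform in the last n−l variables). Then for every h = (x,y,t) in the Heisenberg group H and every Schwartz function f: R_{J_l} ( W(h^{J_l}) f ) = W(h) ( R_{J_l} f ), where h^{J_l} = ((x⁽¹⁾, y⁽²⁾), (y⁽¹⁾, −x⁽²⁾), t) with x = (x⁽¹⁾,x⁽²⁾), y = (y⁽¹⁾,y⁽²⁾) split into first l and last n−l coordinates. -/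

import Mathlib

open Matrix MeasureTheory

/-- `e(t) = exp(2πit)`. -/
noncomputable def eTwoPi (t : ℝ) : ℂ := Complex.exp (2 * Real.pi * Complex.I * t)

/-- The Schrödinger representation on `ℝⁿ = ℝˡ × ℝᵐ`:
`(W(x,y,t)f)(w) = e(−t + ½xyᵀ + wyᵀ) f(w+x)`. -/
noncomputable def schrodingerW {l m : ℕ}
    (x y : (Fin l → ℝ) × (Fin m → ℝ)) (t : ℝ)
    (f : (Fin l → ℝ) × (Fin m → ℝ) → ℂ) : (Fin l → ℝ) × (Fin m → ℝ) → ℂ :=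
  fun w => eTwoPi (-t + (1 / 2) * (x.1 ⬝ᵥ y.1 + x.2 ⬝ᵥ y.2) + (w.1 ⬝ᵥ y.1 + w.2 ⬝ᵥ y.2)) *
    f (w.1 + x.1, w.2 + x.2)

/-- The partial Fourier transform in the last `m` variables:
`(R_{J_l} f)(x⁽¹⁾,x⁽²⁾) = ∫ f(x⁽¹⁾,u) e(−x⁽²⁾uᵀ) du`. -/
noncomputable def partialFourier {l m : ℕ}
    (f : (Fin l → ℝ) × (Fin m → ℝ) → ℂ) : (Fin l → ℝ) × (Fin m → ℝ) → ℂ :=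
  fun x => ∫ u : Fin m → ℝ, f (x.1, u) * eTwoPi (-(x.2 ⬝ᵥ u))

theorem eTwoPi_add (s t : ℝ) : eTwoPi (s + t) = eTwoPi s * eTwoPi t := by
  simp only [eTwoPi, Complex.ofReal_add, mul_add, Complex.exp_add]

/-- Segal–Shale–Weil operator for the Fourier element `J_l`.
For `h = (x,y,t)` in the Heisenberg group and a Schwartz function `f` on
`ℝⁿ = ℝˡ × ℝ^{n−l}`:  `R_{J_l}(W(h^{J_l}) f) = W(h)(R_{J_l} f)`, where
`h^{J_l} = ((x⁽¹⁾,y⁽²⁾),(y⁽¹⁾,−x⁽²⁾),t)`. -/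
theorem weil_rep_fourier_element (l m : ℕ)
    (f : SchwartzMap ((Fin l → ℝ) × (Fin m → ℝ)) ℂ) :
    ∀ (x₁ y₁ : Fin l → ℝ) (x₂ y₂ : Fin m → ℝ) (t : ℝ),
      partialFourier (schrodingerW (x₁, y₂) (y₁, -x₂) t ⇑f) =
        schrodingerW (x₁, x₂) (y₁, y₂) t (partialFourier ⇑f) := by
  intro x₁ y₁ x₂ y₂ t
  funext w
  simp only [partialFourier, schrodingerW]
  rw [← integral_const_mul, ← integral_add_right_eq_self
    (fun u : Fin m → ℝ => eTwoPi (-t + 1 / 2 * (x₁ ⬝ᵥ y₁ + x₂ ⬝ᵥ y₂) + (w.1 ⬝ᵥ y₁ + w.2 ⬝ᵥ y₂)) *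
      (f (w.1 + x₁, u) * eTwoPi (-((w.2 + x₂) ⬝ᵥ u)))) y₂]
  refine integral_congr_ae (.of_forall fun u => ?_)
  dsimp only
  rw [mul_right_comm, mul_left_comm, ← eTwoPi_add, ← eTwoPi_add, mul_comm]
  congr 2
  simp only [dotProduct_add, add_dotProduct, dotProduct_neg, dotProduct_comm y₂ x₂,
    dotProduct_comm u x₂]
  ring
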